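/- arXiv:1607.00154 — 3 statements merged into one kernel-verified Lean document; each statement's English description precedes it below -/
import Mathlib

section
/- Let n ≥ 2 be an integer and p > 1. The constant p/(n-1) in the first-order Poincaré inequality on hyperbolic space is never achieved: for every u ∈ C_c^∞(B_n) with u not identically zero, the strict inequality ‖u‖_p < (p/(n-1)) ‖∇_g u‖_p holds. -/
open MeasureTheory

/-- The hyperbolic `L^p` norm of a function on the ball model `B_n`:
`(∫_{B_n} |f(x)|^p (2/(1-|x|²))^n dx)^{1/p}`. -/
noncomputable def hypNorm (n : ℕ) (p : ℝ) (f : EuclideanSpace ℝ (Fin n) → ℝ) : ℝ :=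
  (∫ x in Metric.ball (0 : EuclideanSpace ℝ (Fin n)) 1,
      |f x| ^ p * (2 / (1 - ‖x‖ ^ 2)) ^ n) ^ (1 / p)

/-- The pointwise hyperbolic gradient norm `|∇_g u|_g(x) = ((1-|x|²)/2)|∇u(x)|`. -/
noncomputable def hypGradNorm (n : ℕ) (u : EuclideanSpace ℝ (Fin n) → ℝ)
    (x : EuclideanSpace ℝ (Fin n)) : ℝ :=
  ((1 - ‖x‖ ^ 2) / 2) * ‖gradient u x‖

/-- A function vanishing outside a closed set `K` is `C^k` as soon as it is `C^k` at the points
of an open set containing `K`. -/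
theorem contDiff_of_eq_zero_off_closed {E : Type*} [NormedAddCommGroup E] [NormedSpace ℝ E]
    {k : WithTop ℕ∞} {f : E → ℝ} {K U : Set E} (hK : IsClosed K) (hKU : K ⊆ U)
    (hf : ∀ x ∈ U, ContDiffAt ℝ k f x) (h0 : ∀ x ∉ K, f x = 0) : ContDiff ℝ k f := by
  rw [contDiff_iff_contDiffAt]
  intro x
  by_cases hx : x ∈ K
  · exact hf x (hKU hx)
  · have : f =ᶠ[nhds x] fun _ => (0 : ℝ) := by
      filter_upwards [hK.isOpen_compl.mem_nhds hx] with y hy using h0 y hy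
    exact contDiffAt_const.congr_of_eventuallyEq this

/-- A compactly supported `C^1` function satisfies `∫ ⟨x, ∇f(x)⟩ dx = -n ∫ f(x) dx`. -/
theorem integral_fderiv_apply_self (n : ℕ) {f : EuclideanSpace ℝ (Fin n) → ℝ}
    (hf : ContDiff ℝ 1 f) (hcs : HasCompactSupport f) :
    ∫ x, fderiv ℝ f x x = -(n * ∫ x, f x) := by
  have hdf : Continuous (fderiv ℝ f) := hf.continuous_fderiv one_ne_zero
  have hcd : HasCompactSupport (fderiv ℝ f) := hcs.fderiv ℝ
  have hint (i : Fin n) : Integrable fun x : EuclideanSpace ℝ (Fin n) =>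
      fderiv ℝ f x (EuclideanSpace.single i 1) * x i := by
    refine Continuous.integrable_of_hasCompactSupport (by fun_prop) ?_
    refine hcd.mono fun x hx => ?_
    contrapose! hx
    simp [Function.notMem_support.mp hx]
  have hcoord (i : Fin n) (x : EuclideanSpace ℝ (Fin n)) :
      HasFDerivAt (fun y : EuclideanSpace ℝ (Fin n) => y i)
        (EuclideanSpace.proj i : EuclideanSpace ℝ (Fin n) →L[ℝ] ℝ) x :=
    (EuclideanSpace.proj i : EuclideanSpace ℝ (Fin n) →L[ℝ] ℝ).hasFDerivAt
  have hparts (i : Fin n) :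
      ∫ x : EuclideanSpace ℝ (Fin n), fderiv ℝ f x (EuclideanSpace.single i 1) * x i
        = -∫ x, f x := by
    have hone (x : EuclideanSpace ℝ (Fin n)) :
        fderiv ℝ (fun y : EuclideanSpace ℝ (Fin n) => y i) x (EuclideanSpace.single i 1) = 1 := by
      rw [(hcoord i x).fderiv]
      simp
    have hfi : Integrable f := hf.continuous.integrable_of_hasCompactSupport hcs
    have := integral_mul_fderiv_eq_neg_fderiv_mul_of_integrable (μ := volume) (f := f)
      (g := fun y : EuclideanSpace ℝ (Fin n) => y i) (v := EuclideanSpace.single i 1)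
      (hint i) (by simpa only [hone, mul_one] using hfi)
      (Continuous.integrable_of_hasCompactSupport
        (hf.continuous.mul (by fun_prop)) hcs.mul_right)
      (fun x _ => hf.differentiable one_ne_zero x)
      (fun x _ => (hcoord i x).differentiableAt)
    simp only [hone, mul_one] at this
    linarith
  have hsum (x : EuclideanSpace ℝ (Fin n)) :
      fderiv ℝ f x x = ∑ i, fderiv ℝ f x (EuclideanSpace.single i 1) * x i := by
    have := congrArg (fderiv ℝ f x) ((EuclideanSpace.basisFun (Fin n) ℝ).sum_repr x)
    simpa [map_sum, mul_comm] using this.symm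
  simp_rw [hsum]
  rw [integral_finsetSum _ fun i _ => hint i]
  simp [hparts]

/-- Young's inequality in the form `a^{p-1} c ≤ (1 - 1/p) a^p + c^p / p`. -/
theorem rpow_sub_one_mul_le {p a c : ℝ} (hp : 1 < p) (ha : 0 ≤ a) (hc : 0 ≤ c) :
    a ^ (p - 1) * c ≤ (p - 1) / p * a ^ p + c ^ p / p := by
  have h := Real.young_inequality_of_nonneg (Real.rpow_nonneg ha (p - 1)) hc
    (Real.HolderConjugate.conjExponent hp).symm
  rw [← Real.rpow_mul ha, Real.conjExponent, mul_div_cancel₀ _ (by linarith)] at h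
  calc _ ≤ _ := h
    _ = _ := by field_simp

/-- The derivative of the radial factor in the divergence of the hyperbolic vector field
`tanh r ∂_r`. -/
theorem hasDerivAt_radial_weight (n : ℕ) {s : ℝ} (h0 : 0 ≤ s) (h1 : s < 1) :
    HasDerivAt (fun s : ℝ => (2 / (1 - s)) ^ n * ((1 - s) / (1 + s)))
      ((2 / (1 - s)) ^ n * (n / (1 + s) - 2 / (1 + s) ^ 2)) s := by
  have hs : 1 - s ≠ 0 := by linarith
  have hs' : 1 + s ≠ 0 := by linarith
  have ha : HasDerivAt (fun s : ℝ => 1 - s) (-1) s := (hasDerivAt_id s).const_sub 1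
  have hb : HasDerivAt (fun s : ℝ => 1 + s) 1 s := (hasDerivAt_id s).const_add 1
  have h := ((((hasDerivAt_const s (2 : ℝ)).div ha hs).pow n).mul (ha.div hb hs'))
  refine h.congr_deriv ?_
  rcases n with _ | n
  · simp; field_simp; ring
  · simp only [Pi.div_apply, Pi.pow_apply, Nat.add_sub_cancel, Nat.cast_add, Nat.cast_one, pow_succ]
    field_simp
    ring

/-- Differentiating `|u|^p` against the radial weight along the position vector. -/
theorem fderiv_weighted_rpow_apply_self (n : ℕ) {p : ℝ} (hp : 1 < p)
    {u : EuclideanSpace ℝ (Fin n) → ℝ} {x : EuclideanSpace ℝ (Fin n)}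
    (hu : DifferentiableAt ℝ u x) (hx : ‖x‖ ^ 2 < 1) :
    fderiv ℝ (fun x => |u x| ^ p *
        ((2 / (1 - ‖x‖ ^ 2)) ^ n * ((1 - ‖x‖ ^ 2) / (1 + ‖x‖ ^ 2)))) x x
      = (2 / (1 - ‖x‖ ^ 2)) ^ n * (p * |u x| ^ (p - 2) * u x * fderiv ℝ u x x *
          ((1 - ‖x‖ ^ 2) / (1 + ‖x‖ ^ 2))
        + |u x| ^ p * ((n / (1 + ‖x‖ ^ 2) - 2 / (1 + ‖x‖ ^ 2) ^ 2) * (2 * ‖x‖ ^ 2))) := by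
  have hA := (hasDerivAt_abs_rpow (u x) hp).comp_hasFDerivAt x hu.hasFDerivAt
  have hB := (hasDerivAt_radial_weight n (sq_nonneg ‖x‖) hx).comp_hasFDerivAt x
    (hasFDerivAt_id x).norm_sq
  have h := hA.mul hB
  have e := h.fderiv
  simp only [Function.comp_def, Pi.mul_def, id] at e
  rw [e]
  simp
  ring

/-- The pointwise divergence inequality behind the Poincaré inequality. -/
theorem pointwise_divergence_bound {p N a b t D h ω : ℝ} (hp : 1 < p) (hN : 0 < N)
    {v G : ℝ} (hω : 0 ≤ ω) (ht : 0 ≤ t) (ht1 : t < 1) (hG : 0 ≤ G)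
    (ha : a = |v|) (hD : |D| ≤ G * t) (hb : b = (1 - t ^ 2) / 2 * G)
    (hh : h = (1 - t ^ 2) / (1 + t ^ 2)) :
    ω * (N / p * (a ^ p - (p / N) ^ p * b ^ p) + a ^ p * h ^ 2) ≤
      ω * (p * a ^ (p - 2) * v * D * h
        + a ^ p * (((N + 1) / (1 + t ^ 2) - 2 / (1 + t ^ 2) ^ 2) * (2 * t ^ 2)))
      + (N + 1) * (a ^ p * (ω * h)) := by
  have hp0 : 0 < p := by linarith
  have ht2 : 0 < 1 - t ^ 2 := by nlinarith
  have ht3 : 0 < 1 + t ^ 2 := by positivity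
  have ha0 : 0 ≤ a := ha ▸ abs_nonneg v
  have hb0 : 0 ≤ b := by rw [hb]; positivity
  have hh0 : 0 ≤ h := by rw [hh]; positivity
  have hDh : |D| * h ≤ b := by
    calc |D| * h ≤ G * t * h := by gcongr
      _ = G * (1 - t ^ 2) * (t / (1 + t ^ 2)) := by rw [hh]; ring
      _ ≤ G * (1 - t ^ 2) * (1 / 2) := by
        refine mul_le_mul_of_nonneg_left ?_ (by positivity)
        rw [div_le_div_iff₀ ht3 two_pos]
        nlinarith [sq_nonneg (t - 1)]
      _ = b := by rw [hb]; ring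
  have hav : a ^ (p - 2) * a = a ^ (p - 1) := by
    rcases ha0.eq_or_lt with h0 | h0
    · rw [← h0, mul_zero, Real.zero_rpow (by linarith)]
    · rw [← Real.rpow_add_one h0.ne']
      ring_nf
  have hdrift : -(p * (a ^ (p - 1) * b)) ≤ p * a ^ (p - 2) * v * D * h := by
    refine (abs_le.mp ?_).1
    rw [abs_mul, abs_mul, abs_mul, abs_mul, abs_of_pos hp0, abs_of_nonneg hh0, ← ha,
      abs_of_nonneg (Real.rpow_nonneg ha0 _), mul_assoc p, hav, mul_assoc, mul_assoc]
    gcongr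
  have hY := rpow_sub_one_mul_le hp ha0 (mul_nonneg (div_nonneg hp0.le hN.le) hb0 : 0 ≤ p / N * b)
  rw [Real.mul_rpow (by positivity) hb0] at hY
  have hY' : p * (a ^ (p - 1) * b) ≤
      N * ((p - 1) / p * a ^ p + (p / N) ^ p * b ^ p / p) := by
    calc p * (a ^ (p - 1) * b) = N * (a ^ (p - 1) * (p / N * b)) := by field_simp
      _ ≤ _ := by gcongr
  have hid : ((N + 1) / (1 + t ^ 2) - 2 / (1 + t ^ 2) ^ 2) * (2 * t ^ 2) + (N + 1) * h
      = N + h ^ 2 := by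
    rw [hh]; field_simp; ring
  have hsplit : N * ((p - 1) / p * a ^ p + (p / N) ^ p * b ^ p / p)
      = N * a ^ p - N / p * (a ^ p - (p / N) ^ p * b ^ p) := by
    field_simp; ring
  have key : N / p * (a ^ p - (p / N) ^ p * b ^ p) + a ^ p * h ^ 2 ≤
      p * a ^ (p - 2) * v * D * h + a ^ p * (N + h ^ 2) := by linarith
  rw [← hid] at key
  calc _ ≤ _ := mul_le_mul_of_nonneg_left key hω
    _ = _ := by ring

/-- the constant `p/(n-1)` is never achieved: for nonzero
`u ∈ C_c^∞(B_n)`, `‖u‖_p < (p/(n-1)) ‖∇_g u‖_p`. -/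
theorem poincare_order_one_never_achieved (n : ℕ) (hn : 2 ≤ n) (p : ℝ) (hp : 1 < p)
    (u : EuclideanSpace ℝ (Fin n) → ℝ)
    (hu : ContDiff ℝ (⊤ : ℕ∞) u) (hcs : HasCompactSupport u)
    (hsupp : tsupport u ⊆ Metric.ball (0 : EuclideanSpace ℝ (Fin n)) 1)
    (hne : u ≠ 0) :
    hypNorm n p u < (p / ((n : ℝ) - 1)) * hypNorm n p (hypGradNorm n u) := by
  have hp0 : 0 < p := by linarith
  have hN : 0 < (n : ℝ) - 1 := by
    have : (2 : ℝ) ≤ n := by exact_mod_cast hn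
    linarith
  have hball {x : EuclideanSpace ℝ (Fin n)} (hx : x ∈ Metric.ball 0 1) : ‖x‖ < 1 := by
    simpa using hx
  have hpos {x : EuclideanSpace ℝ (Fin n)} (hx : x ∈ Metric.ball 0 1) : 0 < 1 - ‖x‖ ^ 2 := by
    nlinarith [hball hx, norm_nonneg x]
  have hK : IsClosed (tsupport u) := isClosed_tsupport u
  have hu0 {x} (hx : x ∉ tsupport u) : |u x| ^ p = 0 := by
    rw [image_eq_zero_of_notMem_tsupport hx, abs_zero, Real.zero_rpow hp0.ne']
  have hdu0 {x} (hx : x ∉ tsupport u) : |hypGradNorm n u x| ^ p = 0 := by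
    have : fderiv ℝ u x = 0 :=
      image_eq_zero_of_notMem_tsupport fun h => hx (tsupport_fderiv_subset ℝ h)
    simp [hypGradNorm, gradient, this, Real.zero_rpow hp0.ne']
  have hω {x : EuclideanSpace ℝ (Fin n)} (hx : x ∈ Metric.ball 0 1) :
      ContDiffAt ℝ 1 (fun x : EuclideanSpace ℝ (Fin n) => (2 / (1 - ‖x‖ ^ 2)) ^ n) x :=
    (contDiffAt_const.div (contDiffAt_const.sub (contDiffAt_id.norm_sq ℝ)) (hpos hx).ne').pow n
  have hh (x : EuclideanSpace ℝ (Fin n)) :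
      ContDiffAt ℝ 1 (fun x : EuclideanSpace ℝ (Fin n) => (1 - ‖x‖ ^ 2) / (1 + ‖x‖ ^ 2)) x :=
    (contDiffAt_const.sub (contDiffAt_id.norm_sq ℝ)).div
      (contDiffAt_const.add (contDiffAt_id.norm_sq ℝ)) (by positivity)
  have hup : ContDiff ℝ 1 fun x => |u x| ^ p :=
    (contDiff_norm_rpow (E := ℝ) hp).comp (hu.of_le (by exact_mod_cast le_top))
  have hbc : Continuous fun x => |hypGradNorm n u x| ^ p := by
    have h1 : Continuous (fderiv ℝ u) := hu.continuous_fderiv (by simp)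
    have h2 : Continuous (gradient u) :=
      (InnerProductSpace.toDual ℝ (EuclideanSpace ℝ (Fin n))).symm.continuous.comp h1
    refine Continuous.rpow_const ?_ fun _ => Or.inr hp0.le
    unfold hypGradNorm
    fun_prop
  have hcont {g : EuclideanSpace ℝ (Fin n) → ℝ} (hg : ∀ x ∈ Metric.ball 0 1, ContinuousAt g x)
      (h0 : ∀ x ∉ tsupport u, g x = 0) : Continuous g :=
    contDiff_zero.mp (contDiff_of_eq_zero_off_closed hK hsupp
      (fun x hx => contDiffAt_zero.mpr
        ⟨Metric.ball 0 1, Metric.isOpen_ball.mem_nhds hx,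
          fun y hy => (hg y hy).continuousWithinAt⟩) h0)
  have hsuppc {g : EuclideanSpace ℝ (Fin n) → ℝ} (h0 : ∀ x ∉ tsupport u, g x = 0) :
      HasCompactSupport g := HasCompactSupport.intro hcs (fun x hx => h0 x hx)
  set A : EuclideanSpace ℝ (Fin n) → ℝ := fun x => |u x| ^ p * (2 / (1 - ‖x‖ ^ 2)) ^ n with hA
  set B : EuclideanSpace ℝ (Fin n) → ℝ :=
    fun x => |hypGradNorm n u x| ^ p * (2 / (1 - ‖x‖ ^ 2)) ^ n with hB
  set H : EuclideanSpace ℝ (Fin n) → ℝ :=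
    fun x => A x * ((1 - ‖x‖ ^ 2) / (1 + ‖x‖ ^ 2)) ^ 2 with hH
  set F : EuclideanSpace ℝ (Fin n) → ℝ := fun x => |u x| ^ p *
    ((2 / (1 - ‖x‖ ^ 2)) ^ n * ((1 - ‖x‖ ^ 2) / (1 + ‖x‖ ^ 2))) with hF
  have hA0 : ∀ x ∉ tsupport u, A x = 0 := fun x hx => by simp only [hA, hu0 hx, zero_mul]
  have hB0 : ∀ x ∉ tsupport u, B x = 0 := fun x hx => by simp only [hB, hdu0 hx, zero_mul]
  have hH0 : ∀ x ∉ tsupport u, H x = 0 := fun x hx => by simp only [hH, hA0 x hx, zero_mul]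
  have hF0 : ∀ x ∉ tsupport u, F x = 0 := fun x hx => by simp only [hF, hu0 hx, zero_mul]
  have hAat : ∀ x ∈ Metric.ball 0 1, ContinuousAt A x := fun x hx =>
    hup.continuous.continuousAt.mul (hω hx).continuousAt
  have hAc : Continuous A := hcont hAat hA0
  have hBc : Continuous B := hcont (fun x hx => hbc.continuousAt.mul (hω hx).continuousAt) hB0
  have hHc : Continuous H :=
    hcont (fun x hx => (hAat x hx).mul ((hh x).continuousAt.pow 2)) hH0
  have hF1 : ContDiff ℝ 1 F := contDiff_of_eq_zero_off_closed hK hsupp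
    (fun x hx => hup.contDiffAt.mul ((hω hx).mul (hh x))) hF0
  have hAi : Integrable A := hAc.integrable_of_hasCompactSupport (hsuppc hA0)
  have hBi : Integrable B := hBc.integrable_of_hasCompactSupport (hsuppc hB0)
  have hHi : Integrable H := hHc.integrable_of_hasCompactSupport (hsuppc hH0)
  have hFi : Integrable F := hF1.continuous.integrable_of_hasCompactSupport (hsuppc hF0)
  have hdF0 : ∀ x ∉ tsupport u, fderiv ℝ F x x = 0 := fun x hx => by
    have : fderiv ℝ F x = 0 := image_eq_zero_of_notMem_tsupport fun h =>
      hx (closure_minimal (Function.support_subset_iff'.mpr hF0) hK (tsupport_fderiv_subset ℝ h))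
    simp [this]
  have hdFi : Integrable fun x => fderiv ℝ F x x :=
    Continuous.integrable_of_hasCompactSupport
      ((hF1.continuous_fderiv one_ne_zero).clm_apply continuous_id) (hsuppc hdF0)
  have hAnn (x) (hx : x ∈ Metric.ball 0 1) : 0 ≤ A x := by
    have := hpos hx
    simp only [hA]; positivity
  have hBnn (x) (hx : x ∈ Metric.ball 0 1) : 0 ≤ B x := by
    have := hpos hx
    simp only [hB]; positivity
  have hle (x) : (n - 1) / p * (A x - (p / (n - 1)) ^ p * B x) + H x ≤
      fderiv ℝ F x x + n * F x := by
    by_cases hx : x ∈ tsupport u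
    · have hxb := hsupp hx
      have h1 := hpos hxb
      have hb0 : 0 ≤ hypGradNorm n u x := by unfold hypGradNorm; positivity
      have hD : |fderiv ℝ u x x| ≤ ‖gradient u x‖ * ‖x‖ := by
        rw [gradient, LinearIsometryEquiv.norm_map]
        exact (fderiv ℝ u x).le_opNorm x
      have := pointwise_divergence_bound (ω := (2 / (1 - ‖x‖ ^ 2)) ^ n) hp hN (by positivity)
        (norm_nonneg x) (hball hxb) (norm_nonneg (gradient u x)) (rfl : |u x| = |u x|) hD
        (rfl : hypGradNorm n u x = _) rfl
      rw [hF, fderiv_weighted_rpow_apply_self n hp (hu.differentiable (by simp) x) (by linarith)]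
      simp only [sub_add_cancel] at this
      simp only [hH, hA, hB, abs_of_nonneg hb0]
      linarith
    · simp only [hA0 x hx, hB0 x hx, hH0 x hx, hF0 x hx, hdF0 x hx]
      simp
  have hABi : Integrable fun x => (n - 1) / p * (A x - (p / (n - 1)) ^ p * B x) :=
    (hAi.sub (hBi.const_mul _)).const_mul _
  have hint := integral_mono (hABi.add hHi) (hdFi.add (hFi.const_mul (n : ℝ))) hle
  simp only [Pi.add_apply] at hint
  rw [integral_add hABi hHi,
    integral_add hdFi (hFi.const_mul _), integral_const_mul, integral_const_mul,
    integral_sub hAi (hBi.const_mul _), integral_const_mul,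
    integral_fderiv_apply_self n hF1 (hsuppc hF0), neg_add_cancel] at hint
  have hHpos : 0 < ∫ x, H x := by
    obtain ⟨x, hx⟩ := Function.ne_iff.mp hne
    have hxK : x ∈ tsupport u := subset_tsupport u hx
    have h1 := hpos (hsupp hxK)
    have hux : 0 < |u x| := abs_pos.mpr hx
    refine hHc.integral_pos_of_hasCompactSupport_nonneg_nonzero (x := x) (hsuppc hH0) ?_ ?_
    · intro y
      by_cases hy : y ∈ tsupport u
      · exact mul_nonneg (hAnn y (hsupp hy)) (sq_nonneg _)
      · exact (hH0 y hy).ge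
    · simp only [hH, hA]
      positivity
  have hlt : ∫ x, A x < (p / (n - 1)) ^ p * ∫ x, B x := by
    by_contra! h
    have : 0 ≤ (n - 1) / p * ((∫ x, A x) - (p / (n - 1)) ^ p * ∫ x, B x) :=
      mul_nonneg (by positivity) (by linarith)
    linarith
  have hAset : ∫ x in Metric.ball 0 1, A x = ∫ x, A x :=
    setIntegral_eq_integral_of_forall_compl_eq_zero fun x hx => hA0 x fun h => hx (hsupp h)
  have hBset : ∫ x in Metric.ball 0 1, B x = ∫ x, B x :=
    setIntegral_eq_integral_of_forall_compl_eq_zero fun x hx => hB0 x fun h => hx (hsupp h)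
  have hIA : 0 ≤ ∫ x, A x := hAset ▸ setIntegral_nonneg measurableSet_ball hAnn
  have hIB : 0 ≤ ∫ x, B x := hBset ▸ setIntegral_nonneg measurableSet_ball hBnn
  have hC : 0 ≤ p / ((n : ℝ) - 1) := by positivity
  calc hypNorm n p u = (∫ x, A x) ^ (1 / p) := by rw [hypNorm, hAset]
    _ < ((p / (n - 1)) ^ p * ∫ x, B x) ^ (1 / p) := Real.rpow_lt_rpow hIA hlt (by positivity)
    _ = p / (n - 1) * (∫ x, B x) ^ (1 / p) := by
      rw [Real.mul_rpow (by positivity) hIB, ← Real.rpow_mul hC, mul_one_div_cancel hp0.ne',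
        Real.rpow_one]
    _ = p / (n - 1) * hypNorm n p (hypGradNorm n u) := by rw [hypNorm, hBset]
end

section
/- Let n ≥ 2 be an integer and p > 1. The constant p/(n-1) in the first-order Poincaré inequality on hyperbolic space is sharp: for every real c with 0 < c < p/(n-1) there exists u ∈ C_c^∞(B_n), u not identically zero, such that ‖u‖_p > c ‖∇_g u‖_p. Equivalently, the supremum of ‖u‖_p / ‖∇_g u‖_p over nonzero u ∈ C_c^∞(B_n) equals p/(n-1). -/
open MeasureTheory

open Set Filter Topology

/-- The radial profile `w ↦ w ^ α`, smoothly cut off where `k * w ≤ 1`. -/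
noncomputable def cutoffPow (α k w : ℝ) : ℝ :=
  w ^ α * Real.smoothTransition (k * w - 1)

lemma cutoffPow_eq_zero {α k w : ℝ} (h : k * w ≤ 1) : cutoffPow α k w = 0 := by
  simp [cutoffPow, Real.smoothTransition.zero_of_nonpos (sub_nonpos.2 h)]

lemma contDiff_cutoffPow (α : ℝ) {k : ℝ} (hk : 0 ≤ k) :
    ContDiff ℝ (⊤ : ℕ∞) (cutoffPow α k) := by
  refine contDiff_iff_contDiffAt.2 fun w => ?_
  rcases lt_or_ge 0 w with hw | hw
  · exact (contDiffAt_id.rpow_const_of_ne hw.ne').mul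
      (Real.smoothTransition.contDiff.comp (by fun_prop)).contDiffAt
  · have hlt : ∀ᶠ v in 𝓝 w, k * v < 1 :=
      (by fun_prop : Continuous fun v => k * v).continuousAt.eventually_lt_const
        (by nlinarith [mul_nonneg hk (neg_nonneg.2 hw)])
    exact (contDiffAt_const (c := (0 : ℝ))).congr_of_eventuallyEq
      (hlt.mono fun v hv => cutoffPow_eq_zero hv.le)

lemma abs_cutoffPow_le {α k w : ℝ} (hw : 0 < w) : |cutoffPow α k w| ≤ w ^ α := by
  have h := (Real.rpow_pos_of_pos hw α).le
  rw [cutoffPow, abs_mul, abs_of_nonneg h, abs_of_nonneg (Real.smoothTransition.nonneg _)]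
  exact mul_le_of_le_one_right h (Real.smoothTransition.le_one _)

lemma mul_deriv_cutoffPow (α k : ℝ) {w : ℝ} (hw : 0 < w) :
    w * deriv (cutoffPow α k) w = w ^ α * (α * Real.smoothTransition (k * w - 1) +
      k * w * deriv Real.smoothTransition (k * w - 1)) := by
  have h1 : HasDerivAt (fun v : ℝ => v ^ α) (α * w ^ (α - 1)) w :=
    Real.hasDerivAt_rpow_const (Or.inl hw.ne')
  have h2 : HasDerivAt (fun v : ℝ => k * v - 1) k w := by
    simpa using ((hasDerivAt_id w).const_mul k).sub_const 1
  have h3 : HasDerivAt Real.smoothTransition (deriv Real.smoothTransition (k * w - 1))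
      (k * w - 1) :=
    ((Real.smoothTransition.contDiff (n := 1)).differentiable one_ne_zero _).hasDerivAt
  have h4 := (h1.mul (h3.comp w h2)).deriv
  have h5 : deriv (cutoffPow α k) w = _ := h4
  rw [h5, Real.rpow_sub_one hw.ne']
  simp only [Function.comp]
  field_simp

lemma deriv_smoothTransition_eq_zero {y : ℝ} (hy : y ∉ Icc (0 : ℝ) 1) :
    deriv Real.smoothTransition y = 0 := by
  rcases lt_or_ge y 0 with h | h
  · have : Real.smoothTransition =ᶠ[𝓝 y] fun _ => 0 :=
      (eventually_lt_nhds h).mono fun v hv => Real.smoothTransition.zero_of_nonpos hv.le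
    simp [this.deriv_eq]
  · have : Real.smoothTransition =ᶠ[𝓝 y] fun _ => 1 :=
      (eventually_gt_nhds (not_le.1 fun h' => hy ⟨h, h'⟩)).mono
        fun v hv => Real.smoothTransition.one_of_one_le hv.le
    simp [this.deriv_eq]

lemma exists_bound_mul_deriv_smoothTransition :
    ∃ K : ℝ, 0 ≤ K ∧ ∀ y : ℝ, |y * deriv Real.smoothTransition (y - 1)| ≤ K := by
  have hc : Continuous fun y : ℝ => y * deriv Real.smoothTransition (y - 1) :=
    continuous_id.mul (((Real.smoothTransition.contDiff (n := 1)).continuous_deriv le_rfl).comp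
      (by fun_prop))
  obtain ⟨K, hK⟩ := (isCompact_Icc (a := (1 : ℝ)) (b := 2)).exists_bound_of_continuousOn
    hc.continuousOn
  refine ⟨max K 0, le_max_right _ _, fun y => ?_⟩
  by_cases hy : y ∈ Icc (1 : ℝ) 2
  · exact (hK y hy).trans (le_max_left _ _)
  · rw [deriv_smoothTransition_eq_zero, mul_zero, abs_zero]
    · exact le_max_right _ _
    · rintro ⟨h0, h1⟩
      exact hy ⟨by linarith, by linarith⟩

lemma exists_bound_mul_deriv_cutoffPow (α : ℝ) :
    ∃ M : ℝ, 0 ≤ M ∧ ∀ k w : ℝ, 0 < w → |w * deriv (cutoffPow α k) w| ≤ M * w ^ α := by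
  obtain ⟨K, hK0, hK⟩ := exists_bound_mul_deriv_smoothTransition
  refine ⟨|α| + K, by positivity, fun k w hw => ?_⟩
  have h := (Real.rpow_pos_of_pos hw α).le
  rw [mul_deriv_cutoffPow α k hw, abs_mul, abs_of_nonneg h, mul_comm]
  refine mul_le_mul_of_nonneg_right ((abs_add_le _ _).trans (add_le_add ?_ (hK _))) h
  rw [abs_mul, abs_of_nonneg (Real.smoothTransition.nonneg _)]
  exact mul_le_of_le_one_right (abs_nonneg _) (Real.smoothTransition.le_one _)

lemma cutoffPow_eq_rpow {α k w : ℝ} (h : 2 ≤ k * w) : cutoffPow α k w = w ^ α := by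
  simp [cutoffPow, Real.smoothTransition.one_of_one_le (by linarith : 1 ≤ k * w - 1)]

lemma mul_deriv_cutoffPow_eq {α k w : ℝ} (hw : 0 < w) (h : 2 < k * w) :
    w * deriv (cutoffPow α k) w = α * w ^ α := by
  rw [mul_deriv_cutoffPow α k hw, Real.smoothTransition.one_of_one_le (by linarith),
    deriv_smoothTransition_eq_zero fun h' => by linarith [h'.2]]
  ring

lemma integrableOn_one_sub_sq_rpow {β : ℝ} (hβ : -1 < β) :
    IntegrableOn (fun y : ℝ => (1 - y ^ 2) ^ β) (Ioo 0 1) := by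
  have h1 : IntegrableOn (fun y : ℝ => (1 - y) ^ β) (Icc 0 1) := by
    have := (intervalIntegral.intervalIntegrable_rpow' (a := 0) (b := 1) hβ).comp_sub_left 1
    simp only [sub_zero, sub_self] at this
    exact (intervalIntegrable_iff_integrableOn_Icc_of_le zero_le_one).1 this.symm
  have h2 : ContinuousOn (fun y : ℝ => (1 + y) ^ β) (Icc 0 1) :=
    ContinuousOn.rpow_const (by fun_prop) fun y hy => Or.inl (by linarith [hy.1])
  refine ((h1.mul_continuousOn h2 isCompact_Icc).mono_set Ioo_subset_Icc_self).congr_fun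
    (fun y hy => ?_) measurableSet_Ioo
  change (1 - y) ^ β * (1 + y) ^ β = _
  rw [← Real.mul_rpow (by linarith [hy.2]) (by linarith [hy.1])]
  ring_nf

lemma integrableOn_ball_one_sub_norm_sq_rpow {E : Type*} [NormedAddCommGroup E]
    [NormedSpace ℝ E] [FiniteDimensional ℝ E] [MeasurableSpace E] [BorelSpace E] [Nontrivial E]
    (μ : Measure E) [μ.IsAddHaarMeasure] {β : ℝ} (hβ : -1 < β) :
    IntegrableOn (fun x : E => (1 - ‖x‖ ^ 2) ^ β) (Metric.ball 0 1) μ := by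
  refine (integrableOn_fun_norm_addHaar μ (f := fun y : ℝ => (1 - y ^ 2) ^ β)).2 ?_
  refine (integrableOn_one_sub_sq_rpow hβ).mono'
    (by fun_prop) (ae_restrict_of_forall_mem measurableSet_Ioo fun y hy => ?_)
  have h : 0 ≤ (1 - y ^ 2) ^ β := Real.rpow_nonneg (by nlinarith [hy.1, hy.2]) _
  rw [smul_eq_mul, Real.norm_of_nonneg (mul_nonneg (pow_nonneg hy.1.le _) h)]
  exact mul_le_of_le_one_left h (pow_le_one₀ hy.1.le hy.2.le)

/-- The radial function on the ball with profile `cutoffPow α k` in the variable `1 - |x|²`. -/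
noncomputable def radialCutoff (n : ℕ) (α k : ℝ) (x : EuclideanSpace ℝ (Fin n)) : ℝ :=
  cutoffPow α k (1 - ‖x‖ ^ 2)

lemma one_sub_norm_sq_pos {E : Type*} [SeminormedAddCommGroup E] {x : E}
    (hx : x ∈ Metric.ball (0 : E) 1) : 0 < 1 - ‖x‖ ^ 2 := by
  rw [mem_ball_zero_iff] at hx
  nlinarith [norm_nonneg x]

lemma contDiff_radialCutoff (n : ℕ) (α : ℝ) {k : ℝ} (hk : 0 ≤ k) :
    ContDiff ℝ (⊤ : ℕ∞) (radialCutoff n α k) :=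
  (contDiff_cutoffPow α hk).comp (contDiff_const.sub (contDiff_norm_sq ℝ))

lemma tsupport_radialCutoff_subset (n : ℕ) (α : ℝ) {k : ℝ} (hk : 0 ≤ k) :
    tsupport (radialCutoff n α k) ⊆ Metric.ball 0 1 := by
  have hcl : IsClosed {x : EuclideanSpace ℝ (Fin n) | 1 ≤ k * (1 - ‖x‖ ^ 2)} :=
    isClosed_le continuous_const (by fun_prop)
  refine (closure_minimal (fun x hx => ?_) hcl).trans fun x hx => ?_
  · exact le_of_not_ge fun h => hx (cutoffPow_eq_zero h)
  · have hx' : 1 ≤ k * (1 - ‖x‖ ^ 2) := hx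
    rw [mem_ball_zero_iff]
    by_contra! h
    have : 1 - ‖x‖ ^ 2 ≤ 0 := by nlinarith
    linarith [mul_nonpos_of_nonneg_of_nonpos hk this]

lemma hasCompactSupport_radialCutoff (n : ℕ) (α : ℝ) {k : ℝ} (hk : 0 ≤ k) :
    HasCompactSupport (radialCutoff n α k) :=
  (isCompact_closedBall (0 : EuclideanSpace ℝ (Fin n)) 1).of_isClosed_subset
    (isClosed_tsupport _)
    ((tsupport_radialCutoff_subset n α hk).trans Metric.ball_subset_closedBall)

lemma hypGradNorm_radialCutoff (n : ℕ) (α : ℝ) {k : ℝ} (hk : 0 ≤ k)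
    {x : EuclideanSpace ℝ (Fin n)} (hx : x ∈ Metric.ball 0 1) :
    hypGradNorm n (radialCutoff n α k) x =
      |(1 - ‖x‖ ^ 2) * deriv (cutoffPow α k) (1 - ‖x‖ ^ 2)| * ‖x‖ := by
  have h1 : HasDerivAt (cutoffPow α k) (deriv (cutoffPow α k) (1 - ‖x‖ ^ 2)) (1 - ‖x‖ ^ 2) :=
    ((contDiff_cutoffPow α hk).differentiable (by simp) _).hasDerivAt
  have h2 : HasFDerivAt (fun y : EuclideanSpace ℝ (Fin n) => 1 - ‖y‖ ^ 2)
      (-(2 • innerSL ℝ x)) x :=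
    (hasStrictFDerivAt_norm_sq x).hasFDerivAt.const_sub 1
  have h3 : fderiv ℝ (radialCutoff n α k) x = _ := (h1.comp_hasFDerivAt x h2).fderiv
  have hw := one_sub_norm_sq_pos hx
  rw [hypGradNorm,
    ← (InnerProductSpace.toDual ℝ (EuclideanSpace ℝ (Fin n))).norm_map (gradient _ x), toDual_gradient, h3, norm_smul, norm_neg, two_nsmul, ← two_smul ℝ, norm_smul,
    innerSL_apply_norm, abs_mul, abs_of_pos hw, Real.norm_eq_abs, Real.norm_two]
  ring

lemma continuous_hypGradNorm {n : ℕ} {u : EuclideanSpace ℝ (Fin n) → ℝ}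
    (hu : ContDiff ℝ (⊤ : ℕ∞) u) : Continuous (hypGradNorm n u) := by
  have h : Continuous (gradient u) :=
    (InnerProductSpace.toDual ℝ (EuclideanSpace ℝ (Fin n))).symm.continuous.comp
      (hu.continuous_fderiv (by simp))
  unfold hypGradNorm
  fun_prop

lemma integrableOn_hypNorm_rpow {n : ℕ} (hn : 2 ≤ n) {p α : ℝ} (hα : (n : ℝ) - 1 < α * p) :
    IntegrableOn (fun x : EuclideanSpace ℝ (Fin n) =>
      |(1 - ‖x‖ ^ 2) ^ α| ^ p * (2 / (1 - ‖x‖ ^ 2)) ^ n) (Metric.ball 0 1) := by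
  have : Nontrivial (EuclideanSpace ℝ (Fin n)) := by
    have : Nontrivial (Fin n) := Fin.nontrivial_iff_two_le.2 hn
    infer_instance
  have h := (integrableOn_ball_one_sub_norm_sq_rpow (E := EuclideanSpace ℝ (Fin n)) volume
    (by linarith : -1 < α * p - n)).const_mul (2 ^ n)
  refine IntegrableOn.congr_fun h (fun x hx => ?_) Metric.isOpen_ball.measurableSet
  have hw := one_sub_norm_sq_pos hx
  rw [abs_of_nonneg (by positivity), ← Real.rpow_mul hw.le, Real.rpow_sub hw,
    Real.rpow_natCast, div_pow]
  ring

/-- Dominated convergence for `hypNorm`, with a multiple of `(1 - |x|²) ^ α` as dominating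
function. -/
lemma tendsto_hypNorm {n : ℕ} (hn : 2 ≤ n) {p α M : ℝ} (hp : 1 < p)
    (hα : (n : ℝ) - 1 < α * p) (hM : 0 ≤ M) {f : ℕ → EuclideanSpace ℝ (Fin n) → ℝ}
    {g : EuclideanSpace ℝ (Fin n) → ℝ} (hf : ∀ k, Continuous (f k))
    (hb : ∀ k, ∀ x ∈ Metric.ball 0 1, |f k x| ≤ M * (1 - ‖x‖ ^ 2) ^ α)
    (hlim : ∀ x ∈ Metric.ball 0 1, ∀ᶠ k in atTop, f k x = g x) :
    Tendsto (fun k => hypNorm n p (f k)) atTop (𝓝 (hypNorm n p g)) := by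
  refine Tendsto.rpow_const ?_ (Or.inr (by positivity))
  refine tendsto_integral_of_dominated_convergence
    (fun x => M ^ p * (|(1 - ‖x‖ ^ 2) ^ α| ^ p * (2 / (1 - ‖x‖ ^ 2)) ^ n)) (fun k => ?_) ?_ (fun k => ?_) ?_
  · have h1 : Measurable fun x => |f k x| ^ p :=
      ((hf k).abs.rpow_const fun _ => Or.inr (by linarith)).measurable
    exact (h1.mul (by fun_prop)).aestronglyMeasurable
  · exact (integrableOn_hypNorm_rpow hn hα).const_mul _
  · refine ae_restrict_of_forall_mem Metric.isOpen_ball.measurableSet fun x hx => ?_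
    have hw := one_sub_norm_sq_pos hx
    rw [Real.norm_of_nonneg (by positivity)]
    calc |f k x| ^ p * (2 / (1 - ‖x‖ ^ 2)) ^ n
        ≤ (M * (1 - ‖x‖ ^ 2) ^ α) ^ p * (2 / (1 - ‖x‖ ^ 2)) ^ n := by
          gcongr
          exact hb k x hx
      _ = _ := by
          rw [Real.mul_rpow hM (by positivity), abs_of_nonneg (by positivity), mul_assoc]
  · refine ae_restrict_of_forall_mem Metric.isOpen_ball.measurableSet fun x hx => ?_
    exact tendsto_const_nhds.congr' ((hlim x hx).mono fun k hk => by simp only [hk])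

lemma hypNorm_rpow_pos {n : ℕ} (hn : 2 ≤ n) {p α : ℝ} (hα : (n : ℝ) - 1 < α * p) :
    0 < hypNorm n p fun x => (1 - ‖x‖ ^ 2) ^ α := by
  refine Real.rpow_pos_of_pos ?_ _
  rw [setIntegral_pos_iff_support_of_nonneg_ae _ (integrableOn_hypNorm_rpow hn hα)]
  · refine (Metric.measure_ball_pos volume (0 : EuclideanSpace ℝ (Fin n)) one_pos).trans_le
      (measure_mono fun x hx => ⟨?_, hx⟩)
    have hw := one_sub_norm_sq_pos hx
    exact ne_of_gt (by positivity)
  · refine ae_restrict_of_forall_mem Metric.isOpen_ball.measurableSet fun x hx => ?_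
    have hw := one_sub_norm_sq_pos hx
    simp only [Pi.zero_apply]
    positivity

lemma hypNorm_mul_norm_le {n : ℕ} (hn : 2 ≤ n) {p α : ℝ} (hp : 1 < p) (hα0 : 0 < α)
    (hα : (n : ℝ) - 1 < α * p) :
    hypNorm n p (fun x => α * (1 - ‖x‖ ^ 2) ^ α * ‖x‖) ≤
      α * hypNorm n p fun x => (1 - ‖x‖ ^ 2) ^ α := by
  have hp0 : 0 < p := by linarith
  have hα' : (α ^ p) ^ (1 / p) = α := by
    rw [← Real.rpow_mul hα0.le, mul_one_div_cancel hp0.ne', Real.rpow_one]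
  unfold hypNorm
  have hscale : ∀ X : ℝ, 0 ≤ X → α * X ^ (1 / p) = (α ^ p * X) ^ (1 / p) := fun X hX => by
    rw [Real.mul_rpow (by positivity) hX, hα']
  rw [hscale, ← integral_const_mul]
  · refine Real.rpow_le_rpow ?_ (integral_mono_of_nonneg ?_
      ((integrableOn_hypNorm_rpow hn hα).const_mul _) ?_) (by positivity)
    · refine setIntegral_nonneg Metric.isOpen_ball.measurableSet fun x hx => ?_
      have hw := one_sub_norm_sq_pos hx
      positivity
    · refine ae_restrict_of_forall_mem Metric.isOpen_ball.measurableSet fun x hx => ?_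
      have hw := one_sub_norm_sq_pos hx
      simp only [Pi.zero_apply]
      positivity
    · refine ae_restrict_of_forall_mem Metric.isOpen_ball.measurableSet fun x hx => ?_
      have hw := one_sub_norm_sq_pos hx
      simp only
      rw [← mul_assoc, ← Real.mul_rpow hα0.le (abs_nonneg _)]
      gcongr
      rw [abs_mul, abs_mul, abs_of_pos hα0, abs_norm]
      exact mul_le_of_le_one_right (by positivity) (mem_ball_zero_iff.1 hx).le
  · refine setIntegral_nonneg Metric.isOpen_ball.measurableSet fun x hx => ?_
    have hw := one_sub_norm_sq_pos hx
    positivity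

/-- the constant `p/(n-1)` in the first-order Poincaré inequality is
sharp: for every `0 < c < p/(n-1)` there is a nonzero `u ∈ C_c^∞(B_n)` with
`‖u‖_p > c ‖∇_g u‖_p`. -/
theorem poincare_order_one_sharp (n : ℕ) (hn : 2 ≤ n) (p : ℝ) (hp : 1 < p)
    (c : ℝ) (hc0 : 0 < c) (hc : c < p / ((n : ℝ) - 1)) :
    ∃ u : EuclideanSpace ℝ (Fin n) → ℝ,
      ContDiff ℝ (⊤ : ℕ∞) u ∧ HasCompactSupport u ∧
      tsupport u ⊆ Metric.ball (0 : EuclideanSpace ℝ (Fin n)) 1 ∧ u ≠ 0 ∧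
      c * hypNorm n p (hypGradNorm n u) < hypNorm n p u := by
  have hn1 : (0 : ℝ) < n - 1 := by
    have : (2 : ℝ) ≤ n := by exact_mod_cast hn
    linarith
  have hp0 : 0 < p := by linarith
  have hlt : ((n : ℝ) - 1) / p < 1 / c := by
    rw [div_lt_div_iff₀ hp0 hc0]
    linarith [(lt_div_iff₀ hn1).1 hc]
  obtain ⟨α, hα1, hα2⟩ := exists_between hlt
  have hα0 : 0 < α := (div_pos hn1 hp0).trans hα1
  have hα : (n : ℝ) - 1 < α * p := (div_lt_iff₀ hp0).1 hα1
  have hcα : c * α < 1 := by linarith [(lt_div_iff₀ hc0).1 hα2]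
  obtain ⟨M, hM0, hM⟩ := exists_bound_mul_deriv_cutoffPow α
  have hlarge : ∀ x ∈ Metric.ball (0 : EuclideanSpace ℝ (Fin n)) 1,
      ∀ᶠ k : ℕ in atTop, 2 < (k : ℝ) * (1 - ‖x‖ ^ 2) := fun x hx =>
    (tendsto_natCast_atTop_atTop.atTop_mul_const (one_sub_norm_sq_pos hx)).eventually_gt_atTop 2
  have hu : Tendsto (fun k : ℕ => hypNorm n p (radialCutoff n α k)) atTop
      (𝓝 (hypNorm n p fun x => (1 - ‖x‖ ^ 2) ^ α)) := by
    refine tendsto_hypNorm hn hp hα zero_le_one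
      (fun k => (contDiff_radialCutoff n α k.cast_nonneg).continuous) (fun k x hx => ?_)
      fun x hx => (hlarge x hx).mono fun k hk => cutoffPow_eq_rpow hk.le
    rw [one_mul]
    exact abs_cutoffPow_le (one_sub_norm_sq_pos hx)
  have hgrad : Tendsto (fun k : ℕ => hypNorm n p (hypGradNorm n (radialCutoff n α k))) atTop
      (𝓝 (hypNorm n p fun x => α * (1 - ‖x‖ ^ 2) ^ α * ‖x‖)) := by
    refine tendsto_hypNorm hn hp hα hM0
      (fun k => continuous_hypGradNorm (contDiff_radialCutoff n α k.cast_nonneg))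
      (fun k x hx => ?_) fun x hx => (hlarge x hx).mono fun k hk => ?_
    · rw [hypGradNorm_radialCutoff n α k.cast_nonneg hx, abs_mul, abs_abs, abs_norm]
      exact (mul_le_of_le_one_right (abs_nonneg _) (mem_ball_zero_iff.1 hx).le).trans
        (hM k _ (one_sub_norm_sq_pos hx))
    · have hw := one_sub_norm_sq_pos hx
      rw [hypGradNorm_radialCutoff n α k.cast_nonneg hx, mul_deriv_cutoffPow_eq hw hk,
        abs_of_nonneg (by positivity)]
  have hpos := hypNorm_rpow_pos hn hα
  have hlimit : c * hypNorm n p (fun x => α * (1 - ‖x‖ ^ 2) ^ α * ‖x‖) <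
      hypNorm n p fun x => (1 - ‖x‖ ^ 2) ^ α := by
    calc _ ≤ c * (α * hypNorm n p fun x => (1 - ‖x‖ ^ 2) ^ α) := by
          gcongr
          exact hypNorm_mul_norm_le hn hp hα0 hα
      _ = (c * α) * hypNorm n p fun x => (1 - ‖x‖ ^ 2) ^ α := by ring
      _ < _ := mul_lt_of_lt_one_left hpos hcα
  obtain ⟨k, hk, hk0⟩ := (((hgrad.const_mul c).eventually_lt hu hlimit).and
    (hu.eventually_const_lt hpos)).exists
  refine ⟨radialCutoff n α k, contDiff_radialCutoff n α k.cast_nonneg,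
    hasCompactSupport_radialCutoff n α k.cast_nonneg,
    tsupport_radialCutoff_subset n α k.cast_nonneg, fun h => ?_, hk⟩
  rw [h] at hk0
  simp [hypNorm, hp0.ne'] at hk0
end

section
/- Let n ≥ 2 be an integer, p > 1, and φ(s) = (n ω_n)^{-p/(p-1)} ∫_s^∞ (sinh F(t))^{-p(n-1)/(p-1)} dt. Let g : (0,∞) → [0,∞) be measurable with ∫_0^∞ g(s)^p ds ≤ 1, and define f(s) = ∫_0^{φ(s)} g(t) dt for s > 0. Then (∫_0^∞ f(s)^p ds)^{1/p} < p/(n-1). -/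
open MeasureTheory

/-- `ω_n`: the Lebesgue volume of the unit ball in `ℝ^n`. -/
noncomputable def unitBallVol (n : ℕ) : ℝ :=
  (volume (Metric.ball (0 : EuclideanSpace ℝ (Fin n)) 1)).toReal

/-- The function `φ(s) = (nω_n)^{-p/(p-1)} ∫_s^∞ (sinh F(t))^{-p(n-1)/(p-1)} dt`. -/
noncomputable def phiAux (n : ℕ) (p : ℝ) (F : ℝ → ℝ) (s : ℝ) : ℝ :=
  ((n : ℝ) * unitBallVol n) ^ (-(p / (p - 1))) *
    ∫ t in Set.Ioi s, Real.sinh (F t) ^ (-(p * ((n : ℝ) - 1) / (p - 1)))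

lemma mul_integral_sinh_pow_lt {m : ℕ} (hm : 0 < m) {x : ℝ} (hx : 0 < x) :
    m * ∫ r in (0 : ℝ)..x, Real.sinh r ^ m < Real.sinh x ^ m := by
  have hderiv : ∀ r ∈ Set.uIcc 0 x,
      HasDerivAt (fun r => Real.sinh r ^ m) (m * Real.sinh r ^ (m - 1) * Real.cosh r) r :=
    fun r _ => (Real.hasDerivAt_sinh r).pow m
  have hinteg := intervalIntegral.integral_eq_sub_of_hasDerivAt hderiv
    (Continuous.intervalIntegrable (by fun_prop) _ _)
  have hlt : ∀ r, 0 < r → m * Real.sinh r ^ m < m * Real.sinh r ^ (m - 1) * Real.cosh r := by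
    intro r hr
    have hs : 0 < Real.sinh r := Real.sinh_pos_iff.2 hr
    have hm' : (0 : ℝ) < m := by exact_mod_cast hm
    rw [← mul_pow_sub_one hm.ne' (Real.sinh r), mul_comm (Real.sinh r), ← mul_assoc]
    exact mul_lt_mul_of_pos_left (Real.sinh_lt_cosh r) (by positivity)
  rw [← intervalIntegral.integral_const_mul]
  calc _ < ∫ r in (0 : ℝ)..x, m * Real.sinh r ^ (m - 1) * Real.cosh r :=
        intervalIntegral.integral_lt_integral_of_continuousOn_of_le_of_exists_lt hx
          (by fun_prop) (by fun_prop) (fun r hr => (hlt r hr.1).le)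
          ⟨x, ⟨hx.le, le_rfl⟩, hlt x hx⟩
    _ = _ := by simp [hinteg, hm.ne']

lemma unitBallVol_pos (n : ℕ) : 0 < unitBallVol n :=
  ENNReal.toReal_pos (Metric.measure_ball_pos _ _ one_pos).ne' measure_ball_lt_top.ne

lemma phiAux_nonneg (n : ℕ) (p : ℝ) (F : ℝ → ℝ) (hF0 : ∀ s, 0 ≤ s → 0 ≤ F s) {s : ℝ}
    (hs : 0 < s) : 0 ≤ phiAux n p F s := by
  have := unitBallVol_pos n
  refine mul_nonneg (by positivity) (setIntegral_nonneg measurableSet_Ioi fun t ht => ?_)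
  exact Real.rpow_nonneg (Real.sinh_nonneg_iff.2 (hF0 t (hs.le.trans (le_of_lt ht)))) _

lemma phiAux_lt {n : ℕ} (hn : 2 ≤ n) {p : ℝ} (hp : 1 < p)
    {F : ℝ → ℝ} (hF0 : ∀ s, 0 ≤ s → 0 ≤ F s)
    (hF : ∀ s, 0 ≤ s →
      s = n * unitBallVol n * ∫ r in (0 : ℝ)..(F s), Real.sinh r ^ (n - 1)) {s : ℝ} (hs : 0 < s) :
    phiAux n p F s
      < (p - 1) * ((n : ℝ) - 1) ^ (-(p / (p - 1))) * s ^ (-(1 / (p - 1))) := by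
  have hv := unitBallVol_pos n
  have hp' : 0 < p - 1 := sub_pos.2 hp
  have hn' : (0 : ℝ) < (n : ℝ) - 1 := by
    have : (2 : ℝ) ≤ n := by exact_mod_cast hn
    linarith
  have hcast : ((n - 1 : ℕ) : ℝ) = (n : ℝ) - 1 := by
    rw [Nat.cast_sub (by omega), Nat.cast_one]
  have hA : 0 < (n : ℝ) * unitBallVol n := by
    have : (0 : ℝ) < n := by linarith
    positivity
  have hq : 0 < p / (p - 1) := by positivity
  have hq1 : -(p / (p - 1)) < -1 := by
    rw [neg_lt_neg_iff, lt_div_iff₀ hp']; linarith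
  have hexp : -(p / (p - 1)) + 1 = -(1 / (p - 1)) := by field_simp; ring
  have hpt : ∀ t ∈ Set.Ioi s, ((n : ℝ) * unitBallVol n) ^ (-(p / (p - 1))) *
      Real.sinh (F t) ^ (-(p * ((n : ℝ) - 1) / (p - 1)))
      < ((n : ℝ) - 1) ^ (-(p / (p - 1))) * t ^ (-(p / (p - 1))) := by
    intro t ht
    have ht0 : 0 < t := hs.trans ht
    have hFt : 0 < F t := by
      refine (hF0 t ht0.le).lt_of_ne fun h => ?_
      have := hF t ht0.le
      rw [← h] at this
      simp at this
      exact ht0.ne' this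
    have hsinh : 0 < Real.sinh (F t) := Real.sinh_pos_iff.2 hFt
    have hlt : ((n : ℝ) - 1) * t < (n : ℝ) * unitBallVol n * Real.sinh (F t) ^ (n - 1) := by
      have h1 := mul_integral_sinh_pow_lt (m := n - 1) (by omega) hFt
      rw [hcast] at h1
      have h2 := mul_lt_mul_of_pos_left h1 hA
      have h3 := hF t ht0.le
      calc ((n : ℝ) - 1) * t = ((n : ℝ) - 1) *
            (n * unitBallVol n * ∫ r in (0 : ℝ)..(F t), Real.sinh r ^ (n - 1)) := by rw [← h3]
        _ < _ := by linarith
    have he : Real.sinh (F t) ^ (-(p * ((n : ℝ) - 1) / (p - 1)))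
        = (Real.sinh (F t) ^ (n - 1)) ^ (-(p / (p - 1))) := by
      rw [← Real.rpow_natCast, ← Real.rpow_mul hsinh.le, hcast]
      congr 1; ring
    rw [he, ← Real.mul_rpow hA.le (by positivity), ← Real.mul_rpow hn'.le ht0.le]
    exact Real.rpow_lt_rpow_of_neg (by positivity) hlt (by linarith)
  have hval : (∫ t in Set.Ioi s, ((n : ℝ) - 1) ^ (-(p / (p - 1))) * t ^ (-(p / (p - 1))))
      = (p - 1) * ((n : ℝ) - 1) ^ (-(p / (p - 1))) * s ^ (-(1 / (p - 1))) := by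
    rw [integral_const_mul, integral_Ioi_rpow_of_lt hq1 hs, hexp]
    field_simp
  have hpos : 0 < (p - 1) * ((n : ℝ) - 1) ^ (-(p / (p - 1))) * s ^ (-(1 / (p - 1))) := by
    positivity
  have hinteg : IntegrableOn (fun t : ℝ => ((n : ℝ) - 1) ^ (-(p / (p - 1))) * t ^ (-(p / (p - 1))))
      (Set.Ioi s) := (integrableOn_Ioi_rpow_of_lt hq1 hs).const_mul _
  rw [phiAux, ← integral_const_mul]
  by_cases hi : IntegrableOn (fun t => ((n : ℝ) * unitBallVol n) ^ (-(p / (p - 1))) *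
      Real.sinh (F t) ^ (-(p * ((n : ℝ) - 1) / (p - 1)))) (Set.Ioi s)
  · rw [← hval, ← sub_pos, ← integral_sub hinteg hi]
    refine (setIntegral_pos_iff_support_of_nonneg_ae ?_ (hinteg.sub hi)).2 ?_
    rotate_left
    · refine lt_of_lt_of_le ?_ (measure_mono (s := Set.Ioi s) fun t ht => ⟨?_, ht⟩)
      · simp
      · exact (sub_pos.2 (hpt t ht)).ne'
    · filter_upwards [ae_restrict_mem measurableSet_Ioi] with t ht
      exact (sub_pos.2 (hpt t ht)).le
  · rwa [integral_undef hi]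

lemma lintegral_Ioo_rpow {r u : ℝ} (hr : -1 < r) (hu : 0 ≤ u) :
    ∫⁻ t in Set.Ioo 0 u, ENNReal.ofReal (t ^ r) = ENNReal.ofReal (u ^ (r + 1) / (r + 1)) := by
  have hi := intervalIntegral.intervalIntegrable_rpow' (a := 0) (b := u) hr
  rw [intervalIntegrable_iff_integrableOn_Ioo_of_le hu] at hi
  rw [← ofReal_integral_eq_lintegral_ofReal hi, ← integral_Ioc_eq_integral_Ioo,
    ← intervalIntegral.integral_of_le hu, integral_rpow (Or.inl hr),
    Real.zero_rpow (by linarith), sub_zero]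
  filter_upwards [ae_restrict_mem measurableSet_Ioo] with t ht
  exact Real.rpow_nonneg ht.1.le _

/-- The bound for `(∫_0^u γ)^p` obtained from Hölder's inequality with weight `t^{(p-1)/p^2}`. -/
noncomputable def hardyMajorant (p : ℝ) (γ : ℝ → ENNReal) (u : ℝ) : ENNReal :=
  ENNReal.ofReal ((p / (p - 1)) ^ (p - 1) * u ^ ((p - 1) ^ 2 / p)) *
    ∫⁻ t in Set.Ioo 0 u, γ t ^ p * ENNReal.ofReal (t ^ ((p - 1) / p))

lemma lintegral_rpow_le_hardyMajorant {p : ℝ} (hp : 1 < p) {γ : ℝ → ENNReal} (hγ : Measurable γ)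
    {u : ℝ} (hu : 0 ≤ u) : (∫⁻ t in Set.Ioo 0 u, γ t) ^ p ≤ hardyMajorant p γ u := by
  have hp' : 0 < p - 1 := sub_pos.2 hp
  have hp0 : 0 < p := by linarith
  have hpq : p.HolderConjugate (p / (p - 1)) := Real.HolderConjugate.conjExponent hp
  have h := ENNReal.lintegral_mul_le_Lp_mul_Lq (volume.restrict (Set.Ioo 0 u)) hpq
    (f := fun t => γ t * ENNReal.ofReal (t ^ ((p - 1) / p ^ 2)))
    (g := fun t => ENNReal.ofReal (t ^ (-((p - 1) / p ^ 2)))) (by fun_prop) (by fun_prop)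
  have h1 : ∫⁻ t in Set.Ioo 0 u, γ t = ∫⁻ t in Set.Ioo 0 u,
      ((fun t => γ t * ENNReal.ofReal (t ^ ((p - 1) / p ^ 2))) *
        (fun t => ENNReal.ofReal (t ^ (-((p - 1) / p ^ 2))))) t := by
    refine setLIntegral_congr_fun measurableSet_Ioo fun t ht => ?_
    have ht0 : 0 < t := ht.1
    simp only [Pi.mul_apply]
    rw [mul_assoc, ← ENNReal.ofReal_mul (by positivity), ← Real.rpow_add ht0, add_neg_cancel,
      Real.rpow_zero, ENNReal.ofReal_one, mul_one]
  have h2 : ∫⁻ t in Set.Ioo 0 u, (γ t * ENNReal.ofReal (t ^ ((p - 1) / p ^ 2))) ^ p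
      = ∫⁻ t in Set.Ioo 0 u, γ t ^ p * ENNReal.ofReal (t ^ ((p - 1) / p)) := by
    refine setLIntegral_congr_fun measurableSet_Ioo fun t ht => ?_
    have ht0 : 0 < t := ht.1
    rw [ENNReal.mul_rpow_of_nonneg _ _ hp0.le, ENNReal.ofReal_rpow_of_nonneg (by positivity) hp0.le,
      ← Real.rpow_mul ht0.le]
    congr 3
    field_simp
  have h3 : ∫⁻ t in Set.Ioo 0 u, ENNReal.ofReal (t ^ (-((p - 1) / p ^ 2))) ^ (p / (p - 1))
      = ENNReal.ofReal (p / (p - 1) * u ^ ((p - 1) / p)) := by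
    have hr : -1 < -(1 / p) := by
      rw [neg_lt_neg_iff, div_lt_one hp0]; exact hp
    have he : -(1 / p) + 1 = (p - 1) / p := by field_simp; ring
    have := lintegral_Ioo_rpow hr hu
    rw [he] at this
    rw [show p / (p - 1) * u ^ ((p - 1) / p) = u ^ ((p - 1) / p) / ((p - 1) / p) by field_simp,
      ← this]
    refine setLIntegral_congr_fun measurableSet_Ioo fun t ht => ?_
    have ht0 : 0 < t := ht.1
    rw [ENNReal.ofReal_rpow_of_nonneg (by positivity) (by positivity), ← Real.rpow_mul ht0.le]
    congr 2
    field_simp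
  rw [← h1, h2, h3] at h
  calc (∫⁻ t in Set.Ioo 0 u, γ t) ^ p ≤ _ := ENNReal.rpow_le_rpow h hp0.le
    _ = _ := by
      rw [hardyMajorant, ENNReal.mul_rpow_of_nonneg _ _ hp0.le, ← ENNReal.rpow_mul,
        one_div_mul_cancel hp0.ne', ENNReal.rpow_one, mul_comm, ← ENNReal.rpow_mul,
        ENNReal.ofReal_rpow_of_nonneg (by positivity) (by positivity)]
      congr 2
      have he : 1 / (p / (p - 1)) * p = p - 1 := by field_simp
      rw [he, Real.mul_rpow (by positivity) (by positivity), ← Real.rpow_mul hu]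
      congr 2
      ring

lemma hardyMajorant_lt {p : ℝ} (hp : 1 < p) {γ : ℝ → ENNReal} {u v : ℝ} (hu : 0 ≤ u) (huv : u < v)
    (hfin : ∫⁻ t in Set.Ioi 0, γ t ^ p ≠ ⊤) (hne : hardyMajorant p γ v ≠ 0) :
    hardyMajorant p γ u < hardyMajorant p γ v := by
  have hp' : 0 < p - 1 := sub_pos.2 hp
  have hp0 : 0 < p := by linarith
  have hv : 0 < v := hu.trans_lt huv
  have hfin' : ∫⁻ t in Set.Ioo 0 v, γ t ^ p * ENNReal.ofReal (t ^ ((p - 1) / p)) ≠ ⊤ := by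
    have hle : ∫⁻ t in Set.Ioo 0 v, γ t ^ p * ENNReal.ofReal (t ^ ((p - 1) / p))
        ≤ (∫⁻ t in Set.Ioi 0, γ t ^ p) * ENNReal.ofReal (v ^ ((p - 1) / p)) := by
      rw [← lintegral_mul_const' _ _ ENNReal.ofReal_ne_top]
      refine (setLIntegral_mono' measurableSet_Ioo fun t ht => ?_).trans
        (lintegral_mono_set Set.Ioo_subset_Ioi_self)
      have ht0 : 0 ≤ t := ht.1.le
      have htv : t ≤ v := ht.2.le
      gcongr
    exact ne_top_of_le_ne_top (ENNReal.mul_ne_top hfin ENNReal.ofReal_ne_top) hle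
  unfold hardyMajorant at hne ⊢
  refine lt_of_le_of_lt (mul_le_mul_right
    (lintegral_mono_set (Set.Ioo_subset_Ioo_right huv.le)) _) ?_
  refine ENNReal.mul_lt_mul_left (right_ne_zero_of_mul hne) hfin' ?_
  rw [ENNReal.ofReal_lt_ofReal_iff (by positivity)]
  gcongr

lemma measurable_hardyMajorant_comp {p : ℝ} {γ : ℝ → ENNReal}
    {ψ : ℝ → ℝ} (hψ : Measurable ψ) : Measurable fun s => hardyMajorant p γ (ψ s) := by
  have hm : Measurable fun u => ∫⁻ t in Set.Ioo 0 u, γ t ^ p * ENNReal.ofReal (t ^ ((p - 1) / p)) :=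
    Monotone.measurable fun u v huv => lintegral_mono_set (Set.Ioo_subset_Ioo_right huv)
  unfold hardyMajorant
  exact Measurable.mul (by fun_prop) (hm.comp hψ)

lemma lintegral_hardyMajorant {p : ℝ} (hp : 1 < p) {γ : ℝ → ENNReal} (hγ : Measurable γ)
    {c : ℝ} (hc : 0 < c) :
    ∫⁻ s in Set.Ioi 0, hardyMajorant p γ (c * s ^ (-(1 / (p - 1))))
      = ENNReal.ofReal (p * (p / (p - 1)) ^ (p - 1) * c ^ (p - 1)) *
        ∫⁻ t in Set.Ioi 0, γ t ^ p := by
  have hp' : 0 < p - 1 := sub_pos.2 hp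
  have hp0 : 0 < p := by linarith
  set ψ : ℝ → ℝ := fun s => c * s ^ (-(1 / (p - 1))) with hψ
  have hψm : Measurable ψ := by fun_prop
  set w : ℝ → ENNReal :=
    fun s => ENNReal.ofReal ((p / (p - 1)) ^ (p - 1) * ψ s ^ ((p - 1) ^ 2 / p)) with hw
  have hwm : Measurable w := by fun_prop
  set h : ℝ → ENNReal := fun t => γ t ^ p * ENNReal.ofReal (t ^ ((p - 1) / p)) with hh
  have hhm : Measurable h := by fun_prop
  have hiff : ∀ s t : ℝ, 0 < s → 0 < t → (t < ψ s ↔ s < (t / c) ^ (-(p - 1))) := by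
    intro s t hs ht
    have htc : 0 < t / c := by positivity
    have hinv : ((t / c) ^ (-(p - 1))) ^ (-(1 / (p - 1))) = t / c := by
      rw [← Real.rpow_mul htc.le, show -(p - 1) * -(1 / (p - 1)) = 1 by field_simp, Real.rpow_one]
    rw [hψ, ← div_lt_iff₀' hc]
    nth_rw 1 [← hinv]
    exact Real.rpow_lt_rpow_iff_of_neg (by positivity) hs (by simpa using hp)
  have hL : ∀ s ∈ Set.Ioi (0 : ℝ), hardyMajorant p γ (ψ s)
      = ∫⁻ t in Set.Ioi 0, {x : ℝ × ℝ | x.2 < ψ x.1}.indicator (fun x => w x.1 * h x.2) (s, t) := by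
    intro s _
    have hind : ∀ t, {x : ℝ × ℝ | x.2 < ψ x.1}.indicator (fun x => w x.1 * h x.2) (s, t)
        = (Set.Iio (ψ s)).indicator (fun t => w s * h t) t := fun t => rfl
    simp_rw [hind]
    rw [setLIntegral_indicator measurableSet_Iio, Set.inter_comm, Set.Ioi_inter_Iio,
      lintegral_const_mul _ hhm]
    rfl
  have hR : ∀ t ∈ Set.Ioi (0 : ℝ),
      ∫⁻ s in Set.Ioi 0, {x : ℝ × ℝ | x.2 < ψ x.1}.indicator (fun x => w x.1 * h x.2) (s, t)
      = ENNReal.ofReal (p * (p / (p - 1)) ^ (p - 1) * c ^ (p - 1)) * γ t ^ p := by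
    intro t ht
    have ht0 : 0 < t := ht
    set T := (t / c) ^ (-(p - 1)) with hT
    have hTpos : 0 < T := by positivity
    have hind : ∀ s ∈ Set.Ioi (0 : ℝ),
        {x : ℝ × ℝ | x.2 < ψ x.1}.indicator (fun x => w x.1 * h x.2) (s, t)
        = (Set.Iio T).indicator (fun s => w s * h t) s := by
      intro s hs
      simp only [Set.indicator_apply, Set.mem_ofPred_eq, Set.mem_Iio, hiff s t hs ht, hT]
    rw [setLIntegral_congr_fun measurableSet_Ioi hind,
      setLIntegral_indicator measurableSet_Iio, Set.inter_comm, Set.Ioi_inter_Iio,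
      lintegral_mul_const _ hwm]
    have hwint : ∫⁻ s in Set.Ioo 0 T, w s
        = ENNReal.ofReal ((p / (p - 1)) ^ (p - 1) * c ^ ((p - 1) ^ 2 / p) * (p * T ^ (1 / p))) := by
      have hr : -1 < -((p - 1) / p) := by
        rw [neg_lt_neg_iff, div_lt_one hp0]; linarith
      have he : -((p - 1) / p) + 1 = 1 / p := by field_simp; ring
      have hI := lintegral_Ioo_rpow hr hTpos.le
      rw [he, show T ^ (1 / p) / (1 / p) = p * T ^ (1 / p) by field_simp] at hI
      rw [ENNReal.ofReal_mul (by positivity), ← hI, ← lintegral_const_mul _ (by fun_prop)]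
      refine setLIntegral_congr_fun measurableSet_Ioo fun s hs => ?_
      have hs0 : 0 < s := hs.1
      simp only [hw, hψ]
      rw [← ENNReal.ofReal_mul (by positivity), Real.mul_rpow hc.le (by positivity),
        ← Real.rpow_mul hs0.le, ← mul_assoc]
      congr 3
      field_simp
    have hTp : T ^ (1 / p) = t ^ (-((p - 1) / p)) * c ^ ((p - 1) / p) := by
      rw [hT, ← Real.rpow_mul (by positivity), Real.div_rpow ht0.le hc.le, div_eq_mul_inv,
        ← Real.rpow_neg hc.le]
      congr 2 <;> ring
    have hcc : c ^ ((p - 1) ^ 2 / p) * c ^ ((p - 1) / p) = c ^ (p - 1) := by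
      rw [← Real.rpow_add hc]
      congr 1
      field_simp
      ring
    have htt : t ^ (-((p - 1) / p)) * t ^ ((p - 1) / p) = 1 := by
      rw [← Real.rpow_add ht0, neg_add_cancel, Real.rpow_zero]
    rw [hwint, hTp, show h t = ENNReal.ofReal (t ^ ((p - 1) / p)) * γ t ^ p from mul_comm _ _,
      ← mul_assoc, ← ENNReal.ofReal_mul (by positivity)]
    congr 2
    rw [← hcc]
    linear_combination (p / (p - 1)) ^ (p - 1) * c ^ ((p - 1) ^ 2 / p) * p *
      c ^ ((p - 1) / p) * htt
  have hmeas : Measurable ({x : ℝ × ℝ | x.2 < ψ x.1}.indicator (fun x => w x.1 * h x.2)) :=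
    Measurable.indicator (by fun_prop)
      (measurableSet_lt measurable_snd (hψm.comp measurable_fst))
  rw [setLIntegral_congr_fun measurableSet_Ioi hL,
    lintegral_lintegral_swap (f := fun s t =>
      {x : ℝ × ℝ | x.2 < ψ x.1}.indicator (fun x => w x.1 * h x.2) (s, t)) hmeas.aemeasurable,
    setLIntegral_congr_fun measurableSet_Ioi hR, lintegral_const_mul _ (by fun_prop)]

/-- with `F` the inverse of `Φ(t) = nω_n ∫_0^t (sinh r)^{n-1} dr`, `φ`
as above, and `g ≥ 0` measurable with `∫_0^∞ g^p ≤ 1`, the function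
`f(s) = ∫_0^{φ(s)} g(t) dt` satisfies `(∫_0^∞ f^p)^{1/p} < p/(n-1)`. -/
theorem one_dim_sharp_strict_bound (n : ℕ) (hn : 2 ≤ n) (p : ℝ) (hp : 1 < p)
    (F : ℝ → ℝ) (hF0 : ∀ s, 0 ≤ s → 0 ≤ F s)
    (hF : ∀ s, 0 ≤ s →
      s = n * unitBallVol n * ∫ r in (0 : ℝ)..(F s), Real.sinh r ^ (n - 1))
    (g : ℝ → ℝ) (hg : Measurable g) (hg0 : ∀ t, 0 ≤ g t)
    (hgp : ∫⁻ s in Set.Ioi (0 : ℝ), ENNReal.ofReal (g s ^ p) ≤ 1) :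
    (∫⁻ s in Set.Ioi (0 : ℝ),
        ENNReal.ofReal ((∫ t in Set.Ioo (0 : ℝ) (phiAux n p F s), g t) ^ p)) ^ (1 / p)
      < ENNReal.ofReal (p / ((n : ℝ) - 1)) := by
  have hp' : 0 < p - 1 := sub_pos.2 hp
  have hp0 : 0 < p := by linarith
  have hn' : (0 : ℝ) < (n : ℝ) - 1 := by
    have : (2 : ℝ) ≤ n := by exact_mod_cast hn
    linarith
  set γ : ℝ → ENNReal := fun t => ENNReal.ofReal (g t) with hγ
  have hγm : Measurable γ := hg.ennreal_ofReal
  have hγp : ∫⁻ s in Set.Ioi (0 : ℝ), γ s ^ p ≤ 1 := by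
    simpa only [hγ, ENNReal.ofReal_rpow_of_nonneg (hg0 _) hp0.le] using hgp
  set c : ℝ := (p - 1) * ((n : ℝ) - 1) ^ (-(p / (p - 1))) with hc
  have hcpos : 0 < c := by positivity
  have hψm : Measurable fun s : ℝ => c * s ^ (-(1 / (p - 1))) := by fun_prop
  have hconst : p * (p / (p - 1)) ^ (p - 1) * c ^ (p - 1) = (p / ((n : ℝ) - 1)) ^ p := by
    rw [hc, Real.mul_rpow hp'.le (by positivity), ← Real.rpow_mul hn'.le,
      show -(p / (p - 1)) * (p - 1) = -p by field_simp, Real.div_rpow hp0.le hp'.le,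
      Real.div_rpow hp0.le hn'.le, Real.rpow_neg hn'.le, Real.rpow_sub_one hp0.ne']
    have := (Real.rpow_pos_of_pos hp' (p - 1)).ne'
    field_simp
  have hle : ∀ s ∈ Set.Ioi (0 : ℝ),
      ENNReal.ofReal ((∫ t in Set.Ioo (0 : ℝ) (phiAux n p F s), g t) ^ p)
        ≤ hardyMajorant p γ (phiAux n p F s) := by
    intro s hs
    refine le_trans ?_ (lintegral_rpow_le_hardyMajorant hp hγm (phiAux_nonneg n p F hF0 hs))
    rw [← ENNReal.ofReal_rpow_of_nonneg (integral_nonneg hg0) hp0.le]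
    gcongr
    rw [integral_eq_lintegral_of_nonneg_ae (Filter.Eventually.of_forall hg0)
      hg.aestronglyMeasurable]
    exact ENNReal.ofReal_toReal_le
  have hlt : ∀ s ∈ Set.Ioi (0 : ℝ), hardyMajorant p γ (c * s ^ (-(1 / (p - 1)))) ≠ 0 →
      ENNReal.ofReal ((∫ t in Set.Ioo (0 : ℝ) (phiAux n p F s), g t) ^ p)
        < hardyMajorant p γ (c * s ^ (-(1 / (p - 1)))) := fun s hs hne =>
    (hle s hs).trans_lt (hardyMajorant_lt hp (phiAux_nonneg n p F hF0 hs)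
      (phiAux_lt hn hp hF0 hF hs) (ne_top_of_le_ne_top ENNReal.one_ne_top hγp) hne)
  have hmono : ∀ s ∈ Set.Ioi (0 : ℝ),
      ENNReal.ofReal ((∫ t in Set.Ioo (0 : ℝ) (phiAux n p F s), g t) ^ p)
        ≤ hardyMajorant p γ (c * s ^ (-(1 / (p - 1)))) := by
    intro s hs
    refine (hle s hs).trans ?_
    have hφψ := (phiAux_lt hn hp hF0 hF hs).le
    have := phiAux_nonneg n p F hF0 hs
    unfold hardyMajorant
    gcongr
  have hM : ∫⁻ s in Set.Ioi 0, hardyMajorant p γ (c * s ^ (-(1 / (p - 1))))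
      ≤ ENNReal.ofReal ((p / ((n : ℝ) - 1)) ^ p) := by
    rw [lintegral_hardyMajorant hp hγm hcpos, hconst]
    exact mul_le_of_le_one_right' hγp
  have hlt_int : ∫⁻ s in Set.Ioi (0 : ℝ),
      ENNReal.ofReal ((∫ t in Set.Ioo (0 : ℝ) (phiAux n p F s), g t) ^ p)
        < ENNReal.ofReal ((p / ((n : ℝ) - 1)) ^ p) := by
    have hle_int := setLIntegral_mono' (μ := volume) measurableSet_Ioi hmono
    by_cases hzero : ∫⁻ s in Set.Ioi 0, hardyMajorant p γ (c * s ^ (-(1 / (p - 1)))) = 0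
    · rw [hzero] at hle_int
      exact hle_int.trans_lt (ENNReal.ofReal_pos.2 (by positivity))
    · have hm := measurable_hardyMajorant_comp (p := p) (γ := γ) hψm
      refine lt_of_lt_of_le (lintegral_strict_mono_of_ae_le_of_frequently_ae_lt hm.aemeasurable
        (ne_top_of_le_ne_top ENNReal.ofReal_ne_top (hle_int.trans hM))
        (ae_restrict_of_forall_mem measurableSet_Ioi hmono) fun hev => hzero ?_) hM
      refine (lintegral_eq_zero_iff hm).2 ?_
      filter_upwards [hev, ae_restrict_mem measurableSet_Ioi] with s hs hs0
      by_contra hne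
      exact hs (hlt s hs0 hne).ne
  calc _ < ENNReal.ofReal ((p / ((n : ℝ) - 1)) ^ p) ^ (1 / p) :=
        ENNReal.rpow_lt_rpow hlt_int (by positivity)
    _ = _ := by
      rw [ENNReal.ofReal_rpow_of_nonneg (by positivity) (by positivity),
        ← Real.rpow_mul (by positivity), mul_one_div_cancel hp0.ne', Real.rpow_one]
end
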